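/- For every k there is a constant c_k such that the following holds. Let m ≥ 0, k ≥ m + 1, let γ₁, …, γ_r : G^k → 𝔽₂ be multilinear forms symmetric in their first m variables, and let C, D ≥ 2 be given. Then there exist a positive integer R ≤ C^{D^{c_k·r}} and multilinear forms σ₁, …, σ_s, π₁, …, π_q, ρ₁, …, ρ_t : G^k → 𝔽₂ with s + q + t ≤ r such that: (i) each σ_i, π_i, ρ_i is an 𝔽₂-linear combination of γ₁, …, γ_r; (ii) prank(σ_i + σ_i∘(m, m+1)) ≤ R for each i ∈ [s]; (iii) prank(Σ_{ℓ∈[m+1]} π_i∘(ℓ, m+1)) ≤ R for each i ∈ [q]; (iv) every 𝔽₂-linear combination of the forms σ_i (i ∈ [s]), π_i∘(ℓ, m+1) (i ∈ [q], ℓ ∈ [m+1]), and ρ_i∘(ℓ, m+1) (i ∈ [t], ℓ ∈ [m+1]) has partition rank at least (C(R + 2r))^D, unless the nonzero coefficients appear only next to the forms π_i∘(ℓ, m+1) and for each i do not depend on ℓ (i.e. the combination is an 𝔽₂-linear combination of the sums Σ_{ℓ∈[m+1]} π_i∘(ℓ, m+1), i ∈ [q]); (v) for every j ∈ [r], γ_j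 lies in span{σ_i : i ∈ [s]} + span{π_i∘(ℓ, m+1) : i ∈ [q], ℓ ∈ [m+1]} + span{ρ_i∘(ℓ, m+1) : i ∈ [t], ℓ ∈ [m+1]} + {multilinear forms of partition rank ≤ R}. -/

import Mathlib

open Finset

/-- `β : (Fin k → V) → ZMod 2` is a multilinear form in the variables indexed by `S`:
it depends only on the coordinates in `S` and is additive (hence `𝔽₂`-linear) in each of
those coordinates. -/
def MultilinearOn {V : Type*} [AddCommGroup V] [Module (ZMod 2) V] (k : ℕ)
    (S : Finset (Fin k)) (β : (Fin k → V) → ZMod 2) : Prop :=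
  (∀ x y : Fin k → V, (∀ i ∈ S, x i = y i) → β x = β y) ∧
  (∀ i ∈ S, ∀ (x : Fin k → V) (u v : V),
    β (Function.update x i (u + v)) = β (Function.update x i u) + β (Function.update x i v))

/-- A multilinear form in all `k` variables. -/
def IsMultilinear {V : Type*} [AddCommGroup V] [Module (ZMod 2) V] (k : ℕ)
    (α : (Fin k → V) → ZMod 2) : Prop :=
  MultilinearOn k Finset.univ α

/-- `α`, a multilinear form in the variables indexed by `S`, admits a partition-rank
decomposition with `m` terms. -/
def PrankDecompOn {V : Type*} [AddCommGroup V] [Module (ZMod 2) V] (k : ℕ)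
    (S : Finset (Fin k)) (m : ℕ) (α : (Fin k → V) → ZMod 2) : Prop :=
  ∃ (I : Fin m → Finset (Fin k)) (β γ : Fin m → ((Fin k → V) → ZMod 2)),
    (∀ i, I i ⊆ S) ∧ (∀ i, I i ≠ ∅) ∧ (∀ i, I i ≠ S) ∧
    (∀ i, MultilinearOn k (I i) (β i)) ∧
    (∀ i, MultilinearOn k (S \ I i) (γ i)) ∧
    (∀ x, α x = ∑ i, β i x * γ i x)

/-- The partition rank of a multilinear form in the variables indexed by `S`. -/
noncomputable def prankOn {V : Type*} [AddCommGroup V] [Module (ZMod 2) V] (k : ℕ)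
    (S : Finset (Fin k)) (α : (Fin k → V) → ZMod 2) : ℕ :=
  sInf {m | PrankDecompOn k S m α}

/-- The partition rank of a multilinear form in `k` variables. -/
noncomputable def prank {V : Type*} [AddCommGroup V] [Module (ZMod 2) V] (k : ℕ)
    (α : (Fin k → V) → ZMod 2) : ℕ :=
  prankOn k Finset.univ α

/-- `α ∘ π`: the form `(x₁, …, x_k) ↦ α(x_{π⁻¹(1)}, …, x_{π⁻¹(k)})`. -/
def permForm {V : Type*} (k : ℕ) (π : Equiv.Perm (Fin k))
    (α : (Fin k → V) → ZMod 2) : (Fin k → V) → ZMod 2 :=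
  fun x => α (fun i => x (π.symm i))

/-- `α` is symmetric in its first `m` variables (0-indexed: coordinates `< m`). -/
def SymmetricInFirst {V : Type*} (k m : ℕ) (α : (Fin k → V) → ZMod 2) : Prop :=
  ∀ i j : Fin k, (i : ℕ) < m → (j : ℕ) < m → permForm k (Equiv.swap i j) α = α

/-- `α` is symmetric in all of its variables. -/
def SymmetricForm {V : Type*} (k : ℕ) (α : (Fin k → V) → ZMod 2) : Prop :=
  ∀ π : Equiv.Perm (Fin k), permForm k π α = α

/-- `σ` is strongly symmetric: it is symmetric, and the form
`(x, y₃, …, y_k) ↦ σ(x, x, y₃, …, y_k)` is also symmetric.  (Given the symmetry of `σ`,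
the latter is equivalent to being allowed to swap the doubled variable with the third
variable, which is how it is stated here.) -/
def StronglySymmetric {V : Type*} (k : ℕ) (σ : (Fin k → V) → ZMod 2) : Prop :=
  SymmetricForm k σ ∧
  ∀ (u v : V) (z : Fin k → V),
    σ (fun i => if (i : ℕ) = 0 ∨ (i : ℕ) = 1 then u else if (i : ℕ) = 2 then v else z i) =
    σ (fun i => if (i : ℕ) = 0 ∨ (i : ℕ) = 1 then v else if (i : ℕ) = 2 then u else z i)

lemma exponent_step {C D X a : ℝ} (K : ℕ) (hC : 2 ≤ C) (hD : 2 ≤ D) (hX : 1 ≤ X)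
    (hXa : X ≤ C ^ a) :
    X + 2 * K * (C * X) ^ D ≤ C ^ (D * (a + 2 * (2 * K + 1)) - 2 * (2 * K + 1)) := by
  have hC0 : 0 < C := by linarith
  have h1 : 1 ≤ C * X := by nlinarith
  have h2 : X ≤ (C * X) ^ D := calc
    X ≤ C * X := by nlinarith
    _ = (C * X) ^ (1 : ℝ) := (Real.rpow_one _).symm
    _ ≤ _ := Real.rpow_le_rpow_of_exponent_le h1 (by linarith)
  have h3 : (C * X) ^ D ≤ C ^ (D * (1 + a)) := calc
    (C * X) ^ D ≤ (C ^ (1 + a)) ^ D := by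
      refine Real.rpow_le_rpow (by linarith) ?_ (by linarith)
      rw [Real.rpow_add hC0, Real.rpow_one]
      gcongr
    _ = _ := by rw [← Real.rpow_mul hC0.le, mul_comm]
  have h4 : (1 + 2 * K : ℝ) ≤ C ^ (2 * K : ℝ) := calc
    (1 + 2 * K : ℝ) ≤ 2 ^ (2 * K) := by
      have := (Nat.lt_two_pow_self (n := 2 * K))
      exact_mod_cast (by omega : 1 + 2 * K ≤ 2 ^ (2 * K))
    _ ≤ C ^ (2 * K) := by gcongr
    _ = _ := by rw [← Real.rpow_natCast]; push_cast; rfl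
  calc X + 2 * K * (C * X) ^ D ≤ (1 + 2 * K) * (C * X) ^ D := by linarith
    _ ≤ C ^ (2 * K : ℝ) * C ^ (D * (1 + a)) := by gcongr
    _ = C ^ (2 * K + D * (1 + a)) := (Real.rpow_add hC0 _ _).symm
    _ ≤ _ := by
      refine Real.rpow_le_rpow_of_exponent_le (by linarith) ?_
      have : (0 : ℝ) ≤ K := K.cast_nonneg
      nlinarith

lemma exponent_bound {D : ℝ} (hD : 2 ≤ D) (K r : ℕ) :
    D ^ (3 * r) * (2 * r + 2 * (2 * K + 1)) - 2 * (2 * K + 1) ≤ D ^ ((4 * K + 7 : ℝ) * r) := by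
  rcases Nat.eq_zero_or_pos r with rfl | hr
  · simp
  have h1 : (2 * r + 2 * (2 * K + 1) : ℝ) ≤ D ^ (2 * r + 2 * (2 * K + 1)) := calc
    (2 * r + 2 * (2 * K + 1) : ℝ) ≤ 2 ^ (2 * r + 2 * (2 * K + 1)) := by
      exact_mod_cast (Nat.lt_two_pow_self (n := 2 * r + 2 * (2 * K + 1))).le
    _ ≤ _ := by gcongr
  have h2 : D ^ ((4 * K + 7 : ℝ) * r) = D ^ ((4 * K + 7) * r) := by
    rw [← Real.rpow_natCast]; push_cast; rfl
  rw [h2]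
  calc D ^ (3 * r) * (2 * r + 2 * (2 * K + 1)) - 2 * (2 * K + 1)
      ≤ D ^ (3 * r) * D ^ (2 * r + 2 * (2 * K + 1)) := by
        have : D ^ (3 * r) * (2 * r + 2 * (2 * K + 1)) ≤
          D ^ (3 * r) * D ^ (2 * r + 2 * (2 * K + 1)) := by gcongr
        have : (0 : ℝ) ≤ K := K.cast_nonneg
        linarith
    _ = D ^ (3 * r + (2 * r + 2 * (2 * K + 1))) := (pow_add _ _ _).symm
    _ ≤ _ := pow_le_pow_right₀ (by linarith) (by nlinarith [Nat.mul_le_mul_left K hr])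

section Orbit

variable {W L : Type*} [AddCommGroup W] [Module (ZMod 2) W] [Fintype L] [DecidableEq L] {r : ℕ}

/-- A rank function `rk` on an `𝔽₂`-space, together with forms `γ j` whose translates
`A ℓ (γ j)` are permuted by the rank-preserving maps `S ℓ ℓ'` in the way in which
transpositions permute `L`. -/
structure OrbitRank (γ : Fin r → W) (A : L → W →ₗ[ZMod 2] W) (S : L → L → W →ₗ[ZMod 2] W)
    (z : L) (rk : W → ℕ) : Prop where
  zero : rk 0 = 0
  add_le : ∀ v w, rk (v + w) ≤ rk v + rk w
  invariant : ∀ a b w, rk (S a b w) = rk w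
  base : ∀ j, A z (γ j) = γ j
  swap : ∀ a b ℓ j, S a b (A ℓ (γ j)) = A (Equiv.swap a b ℓ) (γ j)

/-- The combination with coefficients `c i ℓ` of the translates `A ℓ (g i)`. -/
def orbitComb (A : L → W →ₗ[ZMod 2] W) (g : Fin r → W) (c : Fin r → L → ZMod 2) : W :=
  ∑ ℓ, A ℓ (∑ i, c i ℓ • g i)

/-- Coefficients allowed by a labelling: forms labelled `0` are discarded, and of those labelled
`1` only the translate at `z` is used. -/
def Admissible (z : L) (lab : Fin r → ℕ) (c : Fin r → L → ZMod 2) : Prop :=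
  ∀ i, (lab i = 0 → c i = 0) ∧ (lab i = 1 → ∀ ℓ, ℓ ≠ z → c i ℓ = 0)

/-- Coefficients supported on forms labelled `2` and constant along orbits. -/
def Exceptional (lab : Fin r → ℕ) (c : Fin r → L → ZMod 2) : Prop :=
  ∀ i, (lab i ≠ 2 → c i = 0) ∧ ∀ ℓ ℓ', c i ℓ = c i ℓ'

/-- The forms `g i`, labelled `0` (discarded), `1` (almost symmetric), `2` (almost vanishing
symmetrization) or `3` (no condition), span the `γ j` up to rank `R`. -/
structure SpansUpTo (γ : Fin r → W) (A : L → W →ₗ[ZMod 2] W) (z p : L) (rk : W → ℕ)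
    (g : Fin r → W) (lab : Fin r → ℕ) (R : ℕ) : Prop where
  mem_span : ∀ i, g i ∈ Submodule.span (ZMod 2) (Set.range γ)
  label_le : ∀ i, lab i ≤ 3
  symm : ∀ i, lab i = 1 → rk (g i + A p (g i)) ≤ R
  sum : ∀ i, lab i = 2 → rk (∑ ℓ, A ℓ (g i)) ≤ R
  spans : ∀ j, ∃ c τ, Admissible z lab c ∧ rk τ ≤ R ∧ γ j = orbitComb A g c + τ

lemma zmod_two_eq_one {a : ZMod 2} (h : a ≠ 0) : a = 1 := by
  revert a; decide

lemma add_self_eq_zero_of_zmod_two (w : W) : w + w = 0 := by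
  rw [← two_smul (ZMod 2) w, show (2 : ZMod 2) = 0 from rfl, zero_smul]

variable {γ : Fin r → W} {A : L → W →ₗ[ZMod 2] W} {S : L → L → W →ₗ[ZMod 2] W}
  {z p : L} {rk : W → ℕ} {g : Fin r → W} {lab : Fin r → ℕ} {R : ℕ}

omit [DecidableEq L] in
lemma orbitComb_add (c d : Fin r → L → ZMod 2) :
    orbitComb A g (c + d) = orbitComb A g c + orbitComb A g d := by
  simp [orbitComb, add_smul, sum_add_distrib]

omit [DecidableEq L] in
lemma orbitComb_smul (a : ZMod 2) (c : Fin r → L → ZMod 2) :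
    orbitComb A g (a • c) = a • orbitComb A g c := by
  simp [orbitComb, smul_sum, mul_smul]

omit [DecidableEq L] in
/-- Exchanging `g i₀` for a combination of the `g i` involving `g i₀`. -/
lemma orbitComb_update (i₀ : Fin r) (κ : Fin r → ZMod 2) (hκ : κ i₀ = 1)
    (d : Fin r → L → ZMod 2) :
    orbitComb A (Function.update g i₀ (∑ i, κ i • g i))
      (fun i => if i = i₀ then d i₀ else d i + κ i • d i₀) = orbitComb A g d := by
  unfold orbitComb
  refine sum_congr rfl fun ℓ _ => congrArg _ ?_
  rw [← add_sum_erase univ (fun i => d i ℓ • g i) (mem_univ i₀),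
    ← add_sum_erase univ (fun i => _ • Function.update g i₀ _ i) (mem_univ i₀)]
  have h1 : ∑ i ∈ univ.erase i₀, (if i = i₀ then d i₀ else d i + κ i • d i₀) ℓ •
      Function.update g i₀ (∑ i, κ i • g i) i =
      ∑ i ∈ univ.erase i₀, d i ℓ • g i + d i₀ ℓ • ∑ i ∈ univ.erase i₀, κ i • g i := by
    rw [smul_sum, ← sum_add_distrib]
    refine sum_congr rfl fun i hi => ?_
    have hi' : i ≠ i₀ := ne_of_mem_erase hi
    simp [hi', add_smul, mul_smul, smul_comm (d i₀ ℓ)]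
  erw [h1]
  rw [← add_sum_erase univ (fun i => κ i • g i) (mem_univ i₀), hκ]
  simp only [if_true, Function.update_self, one_smul, smul_add]
  have := add_self_eq_zero_of_zmod_two (d i₀ ℓ • ∑ i ∈ univ.erase i₀, κ i • g i)
  rw [add_add_add_comm, this, add_zero]

omit [DecidableEq L] in
lemma SpansUpTo.mono (hs : SpansUpTo γ A z p rk g lab R) {R' : ℕ} (h : R ≤ R') :
    SpansUpTo γ A z p rk g lab R' where
  mem_span := hs.mem_span
  label_le := hs.label_le
  symm i hi := (hs.symm i hi).trans h
  sum i hi := (hs.sum i hi).trans h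
  spans j := by
    obtain ⟨c, τ, hc, hτ, hj⟩ := hs.spans j
    exact ⟨c, τ, hc, hτ.trans h, hj⟩

lemma sum_update_lt {i₀ : Fin r} {a : ℕ} (h : a < lab i₀) :
    ∑ i, Function.update lab i₀ a i < ∑ i, lab i := by
  refine sum_lt_sum (fun i _ => ?_) ⟨i₀, mem_univ _, by simpa using h⟩
  by_cases hi : i = i₀
  · subst hi; simpa using h.le
  · simp [hi]

namespace OrbitRank

variable (H : OrbitRank γ A S z rk)
include H

omit [Fintype L] in
lemma base_span {w : W} (hw : w ∈ Submodule.span (ZMod 2) (Set.range γ)) : A z w = w :=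
  LinearMap.eqOn_span (f := A z) (g := LinearMap.id)
    (by rintro _ ⟨j, rfl⟩; exact H.base j) hw

omit [Fintype L] in
lemma swap_span {w : W} (hw : w ∈ Submodule.span (ZMod 2) (Set.range γ)) (a b ℓ : L) :
    S a b (A ℓ w) = A (Equiv.swap a b ℓ) w :=
  LinearMap.eqOn_span (f := S a b ∘ₗ A ℓ) (g := A (Equiv.swap a b ℓ))
    (by rintro _ ⟨j, rfl⟩; exact H.swap a b ℓ j) hw

omit [Fintype L] in
lemma rank_sum_le {ι : Type*} (s : Finset ι) (f : ι → W) (N : ℕ) (h : ∀ i ∈ s, rk (f i) ≤ N) :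
    rk (∑ i ∈ s, f i) ≤ s.card * N := by
  classical
  induction s using Finset.induction_on with
  | empty => simp [H.zero]
  | insert a s ha ih =>
    rw [sum_insert ha, card_insert_of_notMem ha]
    have h1 := ih fun i hi => h i (mem_insert_of_mem hi)
    have h2 := h a (mem_insert_self _ _)
    have h3 := H.add_le (f a) (∑ i ∈ s, f i)
    linarith

omit [Fintype L] in
lemma rank_smul_le (a : ZMod 2) (w : W) : rk (a • w) ≤ rk w := by
  by_cases h : a = 0
  · simp [h, H.zero]
  · simp [zmod_two_eq_one h]

omit [Fintype L] in
lemma rank_translate_add_translate {w : W} (hw : w ∈ Submodule.span (ZMod 2) (Set.range γ))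
    {a b : L} (hab : a ≠ b) (ℓ : L) : rk (w + A ℓ w) ≤ rk (A a w + A b w) := by
  by_cases hℓ : ℓ = z
  · rw [hℓ, H.base_span hw, add_self_eq_zero_of_zmod_two, H.zero]
    exact Nat.zero_le _
  have h1 : S (Equiv.swap a z b) ℓ (S a z (A a w + A b w)) = w + A ℓ w := by
    have hne : Equiv.swap a z b ≠ z := fun h => hab <| by
      have := congrArg (Equiv.swap a z) h
      simpa using this.symm
    rw [map_add, map_add, H.swap_span hw, H.swap_span hw, Equiv.swap_apply_left,
      H.swap_span hw, H.swap_span hw, Equiv.swap_apply_left,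
      Equiv.swap_apply_of_ne_of_ne hne.symm (Ne.symm hℓ), H.base_span hw]
  rw [← h1, H.invariant, H.invariant]

/-- An almost symmetric form occurring in a combination of small rank can be discarded. -/
lemma spansUpTo_discard (hs : SpansUpTo γ A z p rk g lab R) {c : Fin r → L → ZMod 2}
    (hc : Admissible z lab c) {N : ℕ} (hN : rk (orbitComb A g c) ≤ N) {i₀ : Fin r}
    (hi : lab i₀ = 1) (hci : c i₀ ≠ 0) :
    SpansUpTo γ A z p rk g (Function.update lab i₀ 0) (R + N) where
  mem_span := hs.mem_span
  label_le i := by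
    by_cases h : i = i₀
    · subst h; simp
    · simpa [h] using hs.label_le i
  symm i h1 := by
    by_cases h : i = i₀
    · subst h; simp at h1
    · exact (hs.symm i (by simpa [h] using h1)).trans (Nat.le_add_right _ _)
  sum i h1 := by
    by_cases h : i = i₀
    · subst h; simp at h1
    · exact (hs.sum i (by simpa [h] using h1)).trans (Nat.le_add_right _ _)
  spans j := by
    obtain ⟨d, τ, hd, hτ, hj⟩ := hs.spans j
    have hz : c i₀ z = 1 := by
      refine zmod_two_eq_one fun h => hci ?_
      funext ℓ
      by_cases hℓ : ℓ = z
      · simpa [hℓ] using h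
      · exact (hc i₀).2 hi ℓ hℓ
    refine ⟨d + d i₀ z • c, τ + d i₀ z • orbitComb A g c, ?_, ?_, ?_⟩
    · intro i
      by_cases h : i = i₀
      · subst h
        refine ⟨fun _ => ?_, fun h1 => by simp at h1⟩
        funext ℓ
        by_cases hℓ : ℓ = z
        · simp [hℓ, hz, CharTwo.add_self_eq_zero]
        · simp [(hc i).2 hi ℓ hℓ, (hd i).2 hi ℓ hℓ]
      · rw [Function.update_of_ne h]
        refine ⟨fun h1 => ?_, fun h1 ℓ hℓ => ?_⟩
        · simp [(hc i).1 h1, (hd i).1 h1]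
        · simp [(hc i).2 h1 ℓ hℓ, (hd i).2 h1 ℓ hℓ]
    · exact (H.add_le _ _).trans (add_le_add hτ ((H.rank_smul_le _ _).trans hN))
    · rw [orbitComb_add, orbitComb_smul, hj]
      have := add_self_eq_zero_of_zmod_two (d i₀ z • orbitComb A g c)
      rw [add_add_add_comm, this, add_zero]

/-- A form can be exchanged for a combination that is almost symmetric. -/
lemma spansUpTo_exchange_symm (hs : SpansUpTo γ A z p rk g lab R) {N : ℕ} {i₀ : Fin r}
    (hi : 2 ≤ lab i₀) {κ : Fin r → ZMod 2} (hκ : κ i₀ = 1) (hκ' : ∀ i, lab i ≤ 1 → κ i = 0)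
    (hN : ∀ ℓ, rk ((∑ i, κ i • g i) + A ℓ (∑ i, κ i • g i)) ≤ N) :
    SpansUpTo γ A z p rk (Function.update g i₀ (∑ i, κ i • g i)) (Function.update lab i₀ 1)
      (R + Fintype.card L * N) := by
  set P := ∑ i, κ i • g i with hP
  have hPs : P ∈ Submodule.span (ZMod 2) (Set.range γ) :=
    Submodule.sum_mem _ fun i _ => Submodule.smul_mem _ _ (hs.mem_span i)
  have hcard : 1 ≤ Fintype.card L := Fintype.card_pos_iff.2 ⟨z⟩
  refine ⟨fun i => ?_, fun i => ?_, fun i h1 => ?_, fun i h1 => ?_, fun j => ?_⟩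
  · by_cases h : i = i₀
    · subst h; simpa using hPs
    · simpa [h] using hs.mem_span i
  · by_cases h : i = i₀
    · subst h; simp
    · simpa [h] using hs.label_le i
  · by_cases h : i = i₀
    · subst h
      rw [Function.update_self]
      nlinarith [hN p]
    · rw [Function.update_of_ne h] at h1 ⊢
      exact (hs.symm i h1).trans (Nat.le_add_right _ _)
  · by_cases h : i = i₀
    · subst h; simp at h1
    · rw [Function.update_of_ne h] at h1 ⊢
      exact (hs.sum i h1).trans (Nat.le_add_right _ _)
  · obtain ⟨d, τ, hd, hτ, hj⟩ := hs.spans j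
    set e : Fin r → L → ZMod 2 := fun i =>
      if i = i₀ then Pi.single z (∑ ℓ, d i₀ ℓ) else d i + κ i • d i₀ with he
    refine ⟨e, τ + ∑ ℓ, d i₀ ℓ • (P + A ℓ P), ?_, ?_, ?_⟩
    · intro i
      by_cases h : i = i₀
      · subst h
        refine ⟨fun h1 => by simp at h1, fun _ ℓ hℓ => ?_⟩
        simp [he, hℓ]
      · rw [Function.update_of_ne h]
        refine ⟨fun h1 => ?_, fun h1 ℓ hℓ => ?_⟩
        · simp [he, h, (hd i).1 h1, hκ' i (by omega)]
        · simp [he, h, (hd i).2 h1 ℓ hℓ, hκ' i (by omega)]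
    · refine (H.add_le _ _).trans (add_le_add hτ ?_)
      exact H.rank_sum_le univ _ N fun ℓ _ => (H.rank_smul_le _ _).trans (hN ℓ)
    · have hsplit : ∀ f : L → ZMod 2, orbitComb A (Function.update g i₀ P)
          (fun i => if i = i₀ then f else d i + κ i • d i₀) =
          ∑ ℓ, f ℓ • A ℓ P +
            ∑ ℓ, A ℓ (∑ i ∈ univ.erase i₀, (d i + κ i • d i₀) ℓ • g i) := by
        intro f
        unfold orbitComb
        rw [← sum_add_distrib]
        refine sum_congr rfl fun ℓ _ => ?_
        rw [← add_sum_erase _ _ (mem_univ i₀), map_add]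
        congr 1
        · simp
        · refine congrArg _ (sum_congr rfl fun i hi => ?_)
          simp [ne_of_mem_erase hi]
      have h1 := orbitComb_update (A := A) (g := g) i₀ κ hκ d
      rw [← hP, hsplit] at h1
      rw [hj, ← h1, he, hsplit]
      have h2 : ∑ ℓ, (Pi.single z (∑ ℓ, d i₀ ℓ) : L → ZMod 2) ℓ • A ℓ P =
          ∑ ℓ, d i₀ ℓ • P := by
        rw [Fintype.sum_eq_single z fun ℓ hℓ => by simp [hℓ], Pi.single_eq_same,
          H.base_span hPs, sum_smul]
      rw [h2]
      simp only [smul_add, sum_add_distrib]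
      have := add_self_eq_zero_of_zmod_two (∑ ℓ, d i₀ ℓ • P)
      refine (add_zero _).symm.trans ?_
      rw [← this]
      abel

omit H [DecidableEq L] in
/-- A form can be exchanged for a combination with almost vanishing symmetrization. -/
lemma spansUpTo_exchange_sum (hs : SpansUpTo γ A z p rk g lab R) {N : ℕ} {i₀ : Fin r}
    (hi : lab i₀ = 3) {κ : Fin r → ZMod 2} (hκ : κ i₀ = 1) (hκ' : ∀ i, lab i ≤ 1 → κ i = 0)
    (hN : rk (∑ ℓ, A ℓ (∑ i, κ i • g i)) ≤ N) :
    SpansUpTo γ A z p rk (Function.update g i₀ (∑ i, κ i • g i)) (Function.update lab i₀ 2)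
      (R + N) := by
  set P := ∑ i, κ i • g i with hP
  have hPs : P ∈ Submodule.span (ZMod 2) (Set.range γ) :=
    Submodule.sum_mem _ fun i _ => Submodule.smul_mem _ _ (hs.mem_span i)
  refine ⟨fun i => ?_, fun i => ?_, fun i h1 => ?_, fun i h1 => ?_, fun j => ?_⟩
  · by_cases h : i = i₀
    · subst h; simpa using hPs
    · simpa [h] using hs.mem_span i
  · by_cases h : i = i₀
    · subst h; simp
    · simpa [h] using hs.label_le i
  · by_cases h : i = i₀
    · subst h; simp at h1
    · rw [Function.update_of_ne h] at h1 ⊢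
      exact (hs.symm i h1).trans (Nat.le_add_right _ _)
  · by_cases h : i = i₀
    · subst h
      rw [Function.update_self]
      omega
    · rw [Function.update_of_ne h] at h1 ⊢
      exact (hs.sum i h1).trans (Nat.le_add_right _ _)
  · obtain ⟨d, τ, hd, hτ, hj⟩ := hs.spans j
    refine ⟨_, τ, ?_, hτ.trans (Nat.le_add_right _ _),
      hj.trans (by rw [← orbitComb_update (A := A) (g := g) i₀ κ hκ d])⟩
    intro i
    by_cases h : i = i₀
    · subst h
      exact ⟨fun h1 => by simp at h1, fun h1 => by simp at h1⟩
    · rw [Function.update_of_ne h]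
      refine ⟨fun h1 => ?_, fun h1 ℓ hℓ => ?_⟩
      · simp [h, (hd i).1 h1, hκ' i (by omega)]
      · simp [h, (hd i).2 h1 ℓ hℓ, hκ' i (by omega)]

/-- A nonexceptional combination of small rank allows one to lower the labelling. -/
lemma exists_improvement (hs : SpansUpTo γ A z p rk g lab R) {c : Fin r → L → ZMod 2}
    (hc : Admissible z lab c) (hex : ¬ Exceptional lab c) {N : ℕ}
    (hN : rk (orbitComb A g c) ≤ N) :
    ∃ g' lab', SpansUpTo γ A z p rk g' lab' (R + 2 * Fintype.card L * N) ∧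
      ∑ i, lab' i < ∑ i, lab i := by
  have hcard : 1 ≤ Fintype.card L := Fintype.card_pos_iff.2 ⟨z⟩
  have hNle : N ≤ 2 * Fintype.card L * N := Nat.le_mul_of_pos_left _ (by omega)
  by_cases h1 : ∃ i₀, lab i₀ = 1 ∧ c i₀ ≠ 0
  · obtain ⟨i₀, hi, hci⟩ := h1
    exact ⟨g, _, (H.spansUpTo_discard hs hc hN hi hci).mono (by omega), sum_update_lt (by omega)⟩
  push Not at h1
  have hlow : ∀ i, lab i ≤ 1 → c i = 0 := fun i hi => by
    rcases Nat.le_one_iff_eq_zero_or_eq_one.1 hi with h | h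
    · exact (hc i).1 h
    · exact h1 i h
  by_cases h2 : ∃ i₀ a b, c i₀ a ≠ c i₀ b
  · obtain ⟨i₀, a, b, hab⟩ := h2
    have hi : 2 ≤ lab i₀ := by
      by_contra h
      exact hab (by rw [hlow i₀ (by omega)]; rfl)
    have hne : a ≠ b := fun h => hab (by rw [h])
    set κ : Fin r → ZMod 2 := fun i => c i a + c i b with hκ
    have hκ₀ : κ i₀ = 1 := zmod_two_eq_one fun h => hab (CharTwo.add_eq_zero.1 h)
    have hκ' : ∀ i, lab i ≤ 1 → κ i = 0 := fun i hi => by simp [hκ, hlow i hi]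
    have hPs : ∑ i, κ i • g i ∈ Submodule.span (ZMod 2) (Set.range γ) :=
      Submodule.sum_mem _ fun i _ => Submodule.smul_mem _ _ (hs.mem_span i)
    have key : A a (∑ i, κ i • g i) + A b (∑ i, κ i • g i) =
        orbitComb A g c + S a b (orbitComb A g c) := by
      have hq : ∀ ℓ, ∑ i, c i ℓ • g i ∈ Submodule.span (ZMod 2) (Set.range γ) := fun ℓ =>
        Submodule.sum_mem _ fun i _ => Submodule.smul_mem _ _ (hs.mem_span i)
      have hS : S a b (orbitComb A g c) =
          ∑ ℓ, A ℓ (∑ i, c i (Equiv.swap a b ℓ) • g i) := by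
        rw [orbitComb, map_sum, ← Equiv.sum_comp (Equiv.swap a b)]
        refine sum_congr rfl fun ℓ _ => ?_
        rw [H.swap_span (hq _), Equiv.swap_apply_self]
      rw [hS, orbitComb, ← sum_add_distrib, ← sum_subset (subset_univ {a, b}), sum_pair hne]
      · simp only [← map_add, ← sum_add_distrib, ← add_smul, Equiv.swap_apply_left,
          Equiv.swap_apply_right, hκ]
        simp only [add_comm]
      · intro ℓ _ hℓ
        simp only [mem_insert, mem_singleton, not_or] at hℓ
        rw [Equiv.swap_apply_of_ne_of_ne hℓ.1 hℓ.2, add_self_eq_zero_of_zmod_two]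
    have hrk : rk (A a (∑ i, κ i • g i) + A b (∑ i, κ i • g i)) ≤ 2 * N := by
      rw [key]
      have := H.add_le (orbitComb A g c) (S a b (orbitComb A g c))
      rw [H.invariant] at this
      omega
    exact ⟨_, _, (H.spansUpTo_exchange_symm hs hi hκ₀ hκ' fun ℓ =>
      (H.rank_translate_add_translate hPs hne ℓ).trans hrk).mono (le_of_eq (by ring)),
      sum_update_lt (by omega)⟩
  · push Not at h2
    have : ∃ i₀, lab i₀ = 3 ∧ c i₀ ≠ 0 := by
      by_contra! h3
      refine hex fun i => ⟨fun hi => ?_, h2 i⟩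
      rcases Nat.lt_or_ge 1 (lab i) with h | h
      · exact h3 i (by have := hs.label_le i; omega)
      · exact hlow i h
    obtain ⟨i₀, hi, hci⟩ := this
    have hκ₀ : c i₀ z = 1 := zmod_two_eq_one fun h => hci (by
      funext ℓ
      rw [h2 i₀ ℓ z, h]; rfl)
    refine ⟨_, _, (spansUpTo_exchange_sum hs hi (κ := fun i => c i z) hκ₀
      (fun i hi => by simp [hlow i hi]) (N := N) ?_).mono (by omega), sum_update_lt (by omega)⟩
    convert hN using 3
    unfold orbitComb
    refine sum_congr rfl fun ℓ _ => ?_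
    simp only [h2 _ ℓ z]

/-- Iterating the improvement step until every nonexceptional combination has large rank. -/
lemma exists_regular_of_spansUpTo {K : ℕ} (hK : Fintype.card L ≤ K) {C D : ℝ} (hC : 2 ≤ C)
    (hD : 2 ≤ D) (n i : ℕ) (hs : SpansUpTo γ A z p rk g lab R) (hn : ∑ i, lab i = n)
    (hi : i + n ≤ 3 * r) (hR : 1 ≤ R)
    (hb : (R + 2 * r : ℝ) ≤
      C ^ (D ^ i * (2 * r + 2 * (2 * K + 1)) - 2 * (2 * K + 1) : ℝ)) :
    ∃ R : ℕ, 1 ≤ R ∧ (R : ℝ) ≤ C ^ (D ^ ((4 * K + 7 : ℝ) * r)) ∧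
      ∃ g lab, SpansUpTo γ A z p rk g lab R ∧
        ∀ c, Admissible z lab c → ¬ Exceptional lab c →
          (C * ((R : ℝ) + 2 * r)) ^ D ≤ rk (orbitComb A g c) := by
  induction n using Nat.strong_induction_on generalizing i g lab R with
  | _ n ih =>
    by_cases hfin : ∀ c, Admissible z lab c → ¬ Exceptional lab c →
        (C * ((R : ℝ) + 2 * r)) ^ D ≤ rk (orbitComb A g c)
    · refine ⟨R, hR, ?_, g, lab, hs, hfin⟩
      have h1 : D ^ i * (2 * r + 2 * (2 * K + 1) : ℝ) ≤
          D ^ (3 * r) * (2 * r + 2 * (2 * K + 1)) := by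
        have : D ^ i ≤ D ^ (3 * r) := pow_le_pow_right₀ (by linarith) (by omega)
        gcongr
      calc (R : ℝ) ≤ R + 2 * r := by
            have : (0 : ℝ) ≤ r := r.cast_nonneg
            linarith
        _ ≤ _ := hb
        _ ≤ _ := Real.rpow_le_rpow_of_exponent_le (by linarith)
            (le_trans (by linarith) (exponent_bound hD K r))
    · push Not at hfin
      obtain ⟨c, hc, hex, hlt⟩ := hfin
      have hF : 0 ≤ (C * ((R : ℝ) + 2 * r)) ^ D := by positivity
      obtain ⟨g', lab', hs', hlab⟩ := H.exists_improvement hs hc hex (Nat.le_floor hlt.le)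
      refine ih _ (hn ▸ hlab) (i + 1) hs' rfl (by omega) (by omega) ?_
      have hX : (1 : ℝ) ≤ R + 2 * r := by
        exact_mod_cast (by omega : 1 ≤ R + 2 * r)
      have hstep := exponent_step K hC hD hX hb
      have hexp : D * (D ^ i * (2 * r + 2 * (2 * K + 1)) - 2 * (2 * K + 1) + 2 * (2 * K + 1)) -
          2 * (2 * K + 1) = D ^ (i + 1) * (2 * r + 2 * (2 * K + 1)) - 2 * (2 * K + 1) := by
        ring
      rw [hexp] at hstep
      refine le_trans ?_ hstep
      have hK' : (Fintype.card L : ℝ) ≤ K := by exact_mod_cast hK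
      have hfl := Nat.floor_le hF
      push_cast
      have : 2 * (Fintype.card L : ℝ) * (⌊(C * ((R : ℝ) + 2 * r)) ^ D⌋₊ : ℝ) ≤
          2 * K * (C * ((R : ℝ) + 2 * r)) ^ D := by gcongr
      linarith

/-- An abstract symmetry-respecting regularity lemma. -/
lemma exists_regular (p : L) {K : ℕ} (hK : Fintype.card L ≤ K) {C D : ℝ} (hC : 2 ≤ C)
    (hD : 2 ≤ D) :
    ∃ R : ℕ, 1 ≤ R ∧ (R : ℝ) ≤ C ^ (D ^ ((4 * K + 7 : ℝ) * r)) ∧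
      ∃ g lab, SpansUpTo γ A z p rk g lab R ∧
        ∀ c, Admissible z lab c → ¬ Exceptional lab c →
          (C * ((R : ℝ) + 2 * r)) ^ D ≤ rk (orbitComb A g c) := by
  refine H.exists_regular_of_spansUpTo hK hC hD (g := γ) (lab := fun _ => 3) (R := 1) (3 * r) 0
    ⟨fun i => Submodule.subset_span ⟨i, rfl⟩, fun _ => le_rfl, fun i h => by simp at h,
      fun i h => by simp at h, fun j => ?_⟩ (by simp [mul_comm]) (by omega) le_rfl ?_
  · refine ⟨Pi.single j (Pi.single z 1), 0, fun i => ⟨fun h => by simp at h,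
      fun h => by simp at h⟩, by simp [H.zero], ?_⟩
    rw [add_zero, orbitComb, Fintype.sum_eq_single z, Fintype.sum_eq_single j]
    · simp [H.base]
    · intro i hi
      simp [hi]
    · intro ℓ hℓ
      rw [Fintype.sum_eq_zero, map_zero]
      intro i
      by_cases hi : i = j
      · subst hi; simp [hℓ]
      · simp [hi]
  · have h1 : ((1 : ℕ) + 2 * r : ℝ) ≤ 2 ^ (2 * r) := by
      have := Nat.lt_two_pow_self (n := 2 * r)
      exact_mod_cast (by omega : 1 + 2 * r ≤ 2 ^ (2 * r))
    refine h1.trans ?_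
    have h2 : D ^ 0 * (2 * r + 2 * (2 * K + 1)) - 2 * (2 * K + 1) = ((2 * r : ℕ) : ℝ) := by
      push_cast; ring
    rw [h2, Real.rpow_natCast]
    gcongr

end OrbitRank

end Orbit

section Multilinear

variable {V : Type*} [AddCommGroup V] [Module (ZMod 2) V] {k : ℕ}

/-- The space of multilinear forms in `k` variables. -/
def multilinearForms (V : Type*) [AddCommGroup V] [Module (ZMod 2) V] (k : ℕ) :
    Submodule (ZMod 2) ((Fin k → V) → ZMod 2) where
  carrier := {α | IsMultilinear k α}
  add_mem' {α β} hα hβ := by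
    refine ⟨fun x y h => ?_, fun i hi x u v => ?_⟩
    · simp [hα.1 x y h, hβ.1 x y h]
    · simp only [Pi.add_apply, hα.2 i hi, hβ.2 i hi]
      ring
  zero_mem' := ⟨fun _ _ _ => rfl, fun _ _ _ _ _ => by simp⟩
  smul_mem' a α hα := by
    refine ⟨fun x y h => ?_, fun i hi x u v => ?_⟩
    · simp [hα.1 x y h]
    · simp only [Pi.smul_apply, hα.2 i hi, smul_add]

lemma MultilinearOn.permForm {S : Finset (Fin k)} {β : (Fin k → V) → ZMod 2}
    (h : MultilinearOn k S β) (π : Equiv.Perm (Fin k)) :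
    MultilinearOn k (S.map π.symm.toEmbedding) (permForm k π β) := by
  refine ⟨fun x y hxy => h.1 _ _ fun i hi => hxy _ (mem_map_of_mem _ hi), fun i hi x u v => ?_⟩
  obtain ⟨j, hj, rfl⟩ := mem_map.1 hi
  have key : ∀ w, (fun i => Function.update x (π.symm.toEmbedding j) w (π.symm i)) =
      Function.update (fun i => x (π.symm i)) j w := fun w => by
    have := Function.update_comp_equiv x π.symm (π.symm.toEmbedding j) w
    simpa [Function.comp_def] using this
  simp only [_root_.permForm, key]
  exact h.2 j hj _ u v

lemma IsMultilinear.permForm {α : (Fin k → V) → ZMod 2} (h : IsMultilinear k α)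
    (π : Equiv.Perm (Fin k)) : IsMultilinear k (permForm k π α) := by
  have := MultilinearOn.permForm h π
  rwa [map_univ_equiv] at this

lemma PrankDecompOn.permForm {m : ℕ} {α : (Fin k → V) → ZMod 2}
    (h : PrankDecompOn k univ m α) (π : Equiv.Perm (Fin k)) :
    PrankDecompOn k univ m (permForm k π α) := by
  obtain ⟨I, β, γ, -, h1, h2, hβ, hγ, hα⟩ := h
  refine ⟨fun i => (I i).map π.symm.toEmbedding, fun i => _root_.permForm k π (β i),
    fun i => _root_.permForm k π (γ i), fun i => subset_univ _, fun i => by simpa using h1 i,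
    fun i hi => h2 i ?_, fun i => (hβ i).permForm π, fun i => ?_, fun x => hα _⟩
  · exact map_injective π.symm.toEmbedding (Eq.trans hi (map_univ_equiv _).symm)
  · have := (hγ i).permForm π
    rwa [show (univ \ I i).map π.symm.toEmbedding = univ \ (I i).map π.symm.toEmbedding by
      rw [Finset.map_sdiff, map_univ_equiv]] at this

omit [AddCommGroup V] [Module (ZMod 2) V] in
lemma permForm_permForm (π τ : Equiv.Perm (Fin k)) (α : (Fin k → V) → ZMod 2) :
    permForm k π (permForm k τ α) = permForm k (τ * π) α :=
  rfl

omit [AddCommGroup V] [Module (ZMod 2) V] in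
lemma permForm_one (α : (Fin k → V) → ZMod 2) : permForm k 1 α = α :=
  rfl

lemma prank_permForm (π : Equiv.Perm (Fin k)) (α : (Fin k → V) → ZMod 2) :
    prank k (permForm k π α) = prank k α := by
  unfold prank prankOn
  congr 1
  ext m
  refine ⟨fun h => ?_, fun h => h.permForm π⟩
  have := h.permForm π⁻¹
  rwa [permForm_permForm, mul_inv_cancel, permForm_one] at this

lemma prank_zero : prank k (0 : (Fin k → V) → ZMod 2) = 0 :=
  Nat.sInf_eq_zero.2 (Or.inl ⟨fun i => i.elim0, fun i => i.elim0, fun i => i.elim0,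
    fun i => i.elim0, fun i => i.elim0, fun i => i.elim0, fun i => i.elim0, fun i => i.elim0,
    fun x => by simp⟩)

lemma prank_eq_zero_of_lt_two (hk : k < 2) (α : (Fin k → V) → ZMod 2) : prank k α = 0 := by
  unfold prank prankOn
  rw [Nat.sInf_eq_zero]
  by_contra! h
  obtain ⟨m, hm⟩ := h.2
  have hm0 : m ≠ 0 := fun h0 => h.1 (h0 ▸ hm)
  obtain ⟨I, -, -, -, h1, h2, -⟩ := hm
  have : Subsingleton (Fin k) := Fin.subsingleton_iff_le_one.2 (by omega)
  obtain ⟨i, hi⟩ := nonempty_iff_ne_empty.2 (h1 ⟨0, by omega⟩)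
  refine h2 ⟨0, by omega⟩ (eq_univ_iff_forall.2 fun j => ?_)
  rwa [Subsingleton.elim j i]

lemma PrankDecompOn.add {m m' : ℕ} {S : Finset (Fin k)} {α α' : (Fin k → V) → ZMod 2}
    (h : PrankDecompOn k S m α) (h' : PrankDecompOn k S m' α') :
    PrankDecompOn k S (m + m') (α + α') := by
  obtain ⟨I, β, γ, h1, h2, h3, h4, h5, h6⟩ := h
  obtain ⟨I', β', γ', h1', h2', h3', h4', h5', h6'⟩ := h'
  refine ⟨Fin.append I I', Fin.append β β', Fin.append γ γ', ?_, ?_, ?_, ?_, ?_, fun x => ?_⟩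
  any_goals
    intro i
    induction i using Fin.addCases
    · simp only [Fin.append_left]; solve_by_elim
    · simp only [Fin.append_right]; solve_by_elim
  simp [Fin.sum_univ_add, h6, h6']

/-- With at least two variables, every multilinear form on `𝔽₂ⁿ` has a decomposition. -/
lemma IsMultilinear.exists_prankDecompOn {n : ℕ} (hk : 2 ≤ k)
    {α : (Fin k → Fin n → ZMod 2) → ZMod 2} (h : IsMultilinear k α) :
    PrankDecompOn k univ n α := by
  let z : Fin k := ⟨0, by omega⟩
  refine ⟨fun _ => {z}, fun j x => x z j, fun j x => α (Function.update x z (Pi.single j 1)),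
    fun _ => subset_univ _, fun _ => singleton_ne_empty _, fun _ hz => ?_, fun j => ?_,
    fun j => ?_, fun x => ?_⟩
  · have := mem_univ (⟨1, by omega⟩ : Fin k)
    rw [← hz, mem_singleton] at this
    simp [z] at this
  · refine ⟨fun x y hxy => congrFun (hxy z (mem_singleton_self z)) j, fun i hi x u v => ?_⟩
    rw [mem_singleton] at hi
    subst hi
    simp
  · refine ⟨fun x y hxy => h.1 _ _ fun i _ => ?_, fun i hi x u v => ?_⟩
    · by_cases hi : i = z
      · subst hi; simp
      · simpa [hi] using hxy i (by simp [hi])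
    · have hi' : i ≠ z := by simpa using hi
      simp only [Function.update_comm hi']
      exact h.2 i (mem_univ _) _ u v
  · let f : (Fin n → ZMod 2) →+ ZMod 2 :=
      AddMonoidHom.mk' (fun u => α (Function.update x z u)) fun u v => h.2 z (mem_univ _) x u v
    have h1 : α x = f.toZModLinearMap 2 (x z) := by simp [f]
    rw [h1, LinearMap.pi_apply_eq_sum_univ]
    refine sum_congr rfl fun j _ => ?_
    rw [smul_eq_mul]
    congr 1
    change _ = f.toZModLinearMap 2 (Pi.single j 1)
    congr 1
    funext i
    simp [Pi.single_apply, eq_comm]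

lemma prank_add_le {n : ℕ} {α β : (Fin k → Fin n → ZMod 2) → ZMod 2} (hα : IsMultilinear k α)
    (hβ : IsMultilinear k β) : prank k (α + β) ≤ prank k α + prank k β := by
  rcases Nat.lt_or_ge k 2 with hk | hk
  · rw [prank_eq_zero_of_lt_two hk]
    exact Nat.zero_le _
  · have h1 : PrankDecompOn k univ (prank k α) α :=
      Nat.sInf_mem (s := {m | PrankDecompOn k univ m α}) ⟨n, hα.exists_prankDecompOn hk⟩
    have h2 : PrankDecompOn k univ (prank k β) β :=
      Nat.sInf_mem (s := {m | PrankDecompOn k univ m β}) ⟨n, hβ.exists_prankDecompOn hk⟩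
    exact Nat.sInf_le (h1.add h2)

/-- Permuting the variables of multilinear forms. -/
def permLinear (V : Type*) [AddCommGroup V] [Module (ZMod 2) V] (π : Equiv.Perm (Fin k)) :
    multilinearForms V k →ₗ[ZMod 2] multilinearForms V k where
  toFun α := ⟨permForm k π α, IsMultilinear.permForm α.2 π⟩
  map_add' _ _ := rfl
  map_smul' _ _ := rfl

/-- Exchanging the variable `ℓ` with the variable `m`. -/
def swapLast (V : Type*) [AddCommGroup V] [Module (ZMod 2) V] {m : ℕ} (hm : m + 1 ≤ k)
    (ℓ : Fin (m + 1)) : multilinearForms V k →ₗ[ZMod 2] multilinearForms V k :=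
  permLinear V (Equiv.swap (Fin.castLE hm ℓ) (Fin.castLE hm (Fin.last m)))

lemma coe_swapLast {m : ℕ} (hm : m + 1 ≤ k) (ℓ : Fin (m + 1)) (α : multilinearForms V k) :
    (swapLast V hm ℓ α : (Fin k → V) → ZMod 2) =
      permForm k (Equiv.swap ⟨ℓ, ℓ.2.trans_le hm⟩ ⟨m, hm⟩) α :=
  rfl

end Multilinear

lemma exists_swap_mul_swap {ι : Type*} [DecidableEq ι] {P : ι → Prop} {a b : ι} (ha : P a)
    (hb : P b) {ℓ : ι} (hℓ : P ℓ) (z : ι) :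
    ∃ u v, (u = v ∨ (P u ∧ u ≠ z ∧ P v ∧ v ≠ z)) ∧
      Equiv.swap ℓ z * Equiv.swap a b =
        Equiv.swap u v * Equiv.swap (Equiv.swap a b ℓ) z := by
  have main : ∀ c, P c → c ≠ z → ∃ u v, (u = v ∨ (P u ∧ u ≠ z ∧ P v ∧ v ≠ z)) ∧
      Equiv.swap ℓ z * Equiv.swap c z =
        Equiv.swap u v * Equiv.swap (Equiv.swap c z ℓ) z := by
    intro c hc hcz
    by_cases h1 : ℓ = c
    · subst h1
      exact ⟨z, z, Or.inl rfl, by simp; rfl⟩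
    by_cases h2 : ℓ = z
    · subst h2
      exact ⟨ℓ, ℓ, Or.inl rfl, by simp⟩
    refine ⟨c, ℓ, Or.inr ⟨hc, hcz, hℓ, h2⟩, ?_⟩
    rw [Equiv.swap_apply_of_ne_of_ne h1 h2, Equiv.mul_swap_eq_swap_mul,
      Equiv.swap_apply_of_ne_of_ne (Ne.symm h1) hcz, Equiv.swap_apply_right]
  by_cases haz : a = z
  · subst haz
    by_cases hba : b = a
    · subst hba
      exact ⟨b, b, Or.inl rfl, by simp; rfl⟩
    · rw [Equiv.swap_comm a b]
      exact main b hb hba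
  by_cases hbz : b = z
  · subst hbz
    exact main a ha haz
  refine ⟨a, b, Or.inr ⟨ha, haz, hb, hbz⟩, ?_⟩
  rw [Equiv.mul_swap_eq_swap_mul (Equiv.swap a b), Equiv.swap_apply_self,
    Equiv.swap_apply_of_ne_of_ne (Ne.symm haz) (Ne.symm hbz)]

lemma orbitRank_permLinear {m k n r : ℕ} (hm : m + 1 ≤ k)
    (γ : Fin r → multilinearForms (Fin n → ZMod 2) k)
    (hγ : ∀ j, SymmetricInFirst k m (γ j : (Fin k → Fin n → ZMod 2) → ZMod 2)) :
    OrbitRank γ (swapLast _ hm)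
      (fun a b => permLinear _ (Equiv.swap (Fin.castLE hm a) (Fin.castLE hm b)))
      (Fin.last m) (fun w => prank k (w : (Fin k → Fin n → ZMod 2) → ZMod 2)) where
  zero := prank_zero
  add_le v w := prank_add_le v.2 w.2
  invariant _ _ _ := prank_permForm _ _
  base j := by
    rw [swapLast, Equiv.swap_self]
    rfl
  swap a b ℓ j := by
    obtain ⟨u, v, huv, h⟩ := exists_swap_mul_swap (P := fun i : Fin k => (i : ℕ) ≤ m)
      (a := Fin.castLE hm a) (b := Fin.castLE hm b) (ℓ := Fin.castLE hm ℓ)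
      (Nat.lt_succ_iff.1 a.2) (Nat.lt_succ_iff.1 b.2) (Nat.lt_succ_iff.1 ℓ.2)
      (Fin.castLE hm (Fin.last m))
    refine Subtype.ext ?_
    change permForm k _ (permForm k _ (γ j).1) = permForm k _ (γ j).1
    rw [permForm_permForm, h, ← permForm_permForm,
      (Fin.castLE_injective hm).map_swap]
    congr 1
    rcases huv with rfl | ⟨hu, hu', hv, hv'⟩
    · rw [Equiv.swap_self]
      rfl
    · exact hγ j u v (lt_of_le_of_ne hu fun h => hu' (Fin.ext h))
        (lt_of_le_of_ne hv fun h => hv' (Fin.ext h))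

section Labels

variable {W L : Type*} [AddCommGroup W] [Module (ZMod 2) W] [Fintype L] {r s q t : ℕ}
  {lab : Fin r → ℕ}

/-- Splitting an admissible combination according to the labels. -/
lemma orbitComb_eq_sum_add_sum_add_sum [DecidableEq L] {A : L → W →ₗ[ZMod 2] W} {z : L}
    {g : Fin r → W} (hA : ∀ i, A z (g i) = g i) (hlab : ∀ i, lab i ≤ 3)
    (e₁ : Fin s ≃ {i // lab i = 1}) (e₂ : Fin q ≃ {i // lab i = 2})
    (e₃ : Fin t ≃ {i // lab i = 3}) {c : Fin r → L → ZMod 2} (hc : Admissible z lab c) :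
    orbitComb A g c = ∑ i, c (e₁ i) z • g (e₁ i) + ∑ i, ∑ ℓ, c (e₂ i) ℓ • A ℓ (g (e₂ i)) +
      ∑ i, ∑ ℓ, c (e₃ i) ℓ • A ℓ (g (e₃ i)) := by
  rw [e₁.sum_comp (fun i => c i z • g i), e₂.sum_comp (fun i => ∑ ℓ, c i ℓ • A ℓ (g i)),
    e₃.sum_comp (fun i => ∑ ℓ, c i ℓ • A ℓ (g i)),
    ← sum_subtype (univ.filter fun i => lab i = 1) (by simp) (fun i => c i z • g i),
    ← sum_subtype (univ.filter fun i => lab i = 2) (by simp)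
      (fun i => ∑ ℓ, c i ℓ • A ℓ (g i)),
    ← sum_subtype (univ.filter fun i => lab i = 3) (by simp)
      (fun i => ∑ ℓ, c i ℓ • A ℓ (g i)), sum_filter, sum_filter, sum_filter,
    ← sum_add_distrib, ← sum_add_distrib, orbitComb]
  simp only [map_sum, map_smul]
  rw [sum_comm]
  refine sum_congr rfl fun i _ => ?_
  have h3 := hlab i
  interval_cases h : lab i
  · simp [(hc i).1 h]
  · simp only [if_true, OfNat.one_ne_ofNat, if_false, add_zero]
    rw [Fintype.sum_eq_single z fun ℓ hℓ => by simp [(hc i).2 h ℓ hℓ], hA]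
  · simp
  · simp

lemma card_labels_le (e₁ : Fin s ≃ {i // lab i = 1}) (e₂ : Fin q ≃ {i // lab i = 2})
    (e₃ : Fin t ≃ {i // lab i = 3}) : s + q + t ≤ r := by
  have h1 := Fintype.card_congr e₁
  have h2 := Fintype.card_congr e₂
  have h3 := Fintype.card_congr e₃
  rw [Fintype.card_fin, Fintype.card_subtype, card_filter] at h1 h2 h3
  calc s + q + t = ∑ i, ((if lab i = 1 then 1 else 0) + (if lab i = 2 then 1 else 0) +
        (if lab i = 3 then 1 else 0)) := by rw [sum_add_distrib, sum_add_distrib, h1, h2, h3]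
    _ ≤ ∑ _i : Fin r, 1 := sum_le_sum fun i _ => by split_ifs <;> omega
    _ = r := by simp

omit [Fintype L] in
/-- Coefficients on the labelled forms assemble to an admissible combination. -/
lemma exists_admissible [DecidableEq L] (z : L) (e₁ : Fin s ≃ {i // lab i = 1})
    (e₂ : Fin q ≃ {i // lab i = 2}) (e₃ : Fin t ≃ {i // lab i = 3}) (lam : Fin s → ZMod 2)
    (mu : Fin q → L → ZMod 2) (nu : Fin t → L → ZMod 2) :
    ∃ c, Admissible z lab c ∧ (∀ i, c (e₁ i) z = lam i) ∧ (∀ i, c (e₂ i) = mu i) ∧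
      ∀ i, c (e₃ i) = nu i := by
  refine ⟨fun i => if h : lab i = 1 then Pi.single z (lam (e₁.symm ⟨i, h⟩)) else
    if h : lab i = 2 then mu (e₂.symm ⟨i, h⟩) else
    if h : lab i = 3 then nu (e₃.symm ⟨i, h⟩) else 0, fun i => ⟨fun h => ?_, fun h ℓ hℓ => ?_⟩,
    fun i => ?_, fun i => ?_, fun i => ?_⟩
  · simp [h]
  · simp [h, hℓ]
  · simp [(e₁ i).2]
  · simp [(e₂ i).2]
  · simp [(e₃ i).2]

end Labels

/-- **Lemma 19 (symmetry-respecting weak regularity lemma).**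
Given multilinear forms `γ₁, …, γ_r : G^k → 𝔽₂` symmetric in their first `m` variables
(`k ≥ m+1`) and parameters `C, D ≥ 2`, there are `R ≤ C^{D^{c_k·r}}` and linear
combinations `σ₁,…,σ_s, π₁,…,π_q, ρ₁,…,ρ_t` of the `γ_j` with `s+q+t ≤ r` such that:
each `σ_i + σ_i∘(m,m+1)` has partition rank `≤ R`; each `Σ_{ℓ∈[m+1]} π_i∘(ℓ,m+1)` has
partition rank `≤ R`; every linear combination of the `σ_i`, `π_i∘(ℓ,m+1)`, and
`ρ_i∘(ℓ,m+1)` has partition rank `≥ (C(R+2r))^D` unless it is a combination of the sums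
`Σ_ℓ π_i∘(ℓ,m+1)`; and every `γ_j` lies in the span of these forms up to a multilinear
form of partition rank `≤ R`. -/
theorem statement13 (k : ℕ) :
    ∃ c : ℝ, 1 ≤ c ∧
      ∀ (m : ℕ) (hm : m + 1 ≤ k) (n r : ℕ)
        (γ : Fin r → ((Fin k → (Fin n → ZMod 2)) → ZMod 2)),
        (∀ i, IsMultilinear k (γ i)) → (∀ i, SymmetricInFirst k m (γ i)) →
        ∀ C D : ℝ, 2 ≤ C → 2 ≤ D →
          ∃ R : ℕ, 1 ≤ R ∧ (R : ℝ) ≤ C ^ (D ^ (c * r)) ∧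
            ∃ s q t : ℕ, s + q + t ≤ r ∧
              ∃ (σ : Fin s → ((Fin k → (Fin n → ZMod 2)) → ZMod 2))
                (π' : Fin q → ((Fin k → (Fin n → ZMod 2)) → ZMod 2))
                (ρ : Fin t → ((Fin k → (Fin n → ZMod 2)) → ZMod 2)),
                -- (i) all the new forms are linear combinations of `γ₁, …, γ_r`
                (∀ i, ∃ cf : Fin r → ZMod 2, ∀ x, σ i x = ∑ j, cf j * γ j x) ∧
                (∀ i, ∃ cf : Fin r → ZMod 2, ∀ x, π' i x = ∑ j, cf j * γ j x) ∧
                (∀ i, ∃ cf : Fin r → ZMod 2, ∀ x, ρ i x = ∑ j, cf j * γ j x) ∧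
                -- (ii) the almost symmetric forms
                (∀ i, prank k (σ i +
                  permForm k (Equiv.swap ⟨m - 1, by omega⟩ ⟨m, by omega⟩) (σ i)) ≤ R) ∧
                -- (iii) the partially symmetric forms
                (∀ i, prank k (fun x => ∑ ℓ : Fin (m + 1),
                  permForm k (Equiv.swap ⟨(ℓ : ℕ), by have := ℓ.isLt; omega⟩
                    ⟨m, by omega⟩) (π' i) x) ≤ R) ∧
                -- (iv) high rank of nonexceptional linear combinations
                (∀ (lam : Fin s → ZMod 2) (mu : Fin q → Fin (m + 1) → ZMod 2)
                   (nu : Fin t → Fin (m + 1) → ZMod 2),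
                  ¬(lam = 0 ∧ nu = 0 ∧ ∀ i ℓ ℓ', mu i ℓ = mu i ℓ') →
                  (C * ((R : ℝ) + 2 * r)) ^ D ≤
                    (prank k (fun x =>
                      (∑ i, lam i * σ i x) +
                      (∑ i, ∑ ℓ : Fin (m + 1), mu i ℓ *
                        permForm k (Equiv.swap ⟨(ℓ : ℕ), by have := ℓ.isLt; omega⟩
                          ⟨m, by omega⟩) (π' i) x) +
                      (∑ i, ∑ ℓ : Fin (m + 1), nu i ℓ *
                        permForm k (Equiv.swap ⟨(ℓ : ℕ), by have := ℓ.isLt; omega⟩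
                          ⟨m, by omega⟩) (ρ i) x)) : ℝ)) ∧
                -- (v) every `γ_j` is in the span of the new forms up to rank ≤ R
                (∀ j, ∃ (lam : Fin s → ZMod 2) (mu : Fin q → Fin (m + 1) → ZMod 2)
                    (nu : Fin t → Fin (m + 1) → ZMod 2)
                    (τ : (Fin k → (Fin n → ZMod 2)) → ZMod 2),
                  IsMultilinear k τ ∧ prank k τ ≤ R ∧
                  ∀ x, γ j x =
                    (∑ i, lam i * σ i x) +
                    (∑ i, ∑ ℓ : Fin (m + 1), mu i ℓ *
                      permForm k (Equiv.swap ⟨(ℓ : ℕ), by have := ℓ.isLt; omega⟩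
                        ⟨m, by omega⟩) (π' i) x) +
                    (∑ i, ∑ ℓ : Fin (m + 1), nu i ℓ *
                      permForm k (Equiv.swap ⟨(ℓ : ℕ), by have := ℓ.isLt; omega⟩
                        ⟨m, by omega⟩) (ρ i) x) + τ x) := by
  refine ⟨4 * k + 7, by linarith [k.cast_nonneg (α := ℝ)], fun m hm n r γ hmul hsym C D hC hD => ?_⟩
  have H := orbitRank_permLinear hm (fun j => (⟨γ j, hmul j⟩ : multilinearForms _ k)) hsym
  obtain ⟨R, hR, hRb, g, lab, hs, hreg⟩ := H.exists_regular ⟨m - 1, by omega⟩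
    (K := k) (by simpa using hm) hC hD
  have e₁ := (Fintype.equivFin {i // lab i = 1}).symm
  have e₂ := (Fintype.equivFin {i // lab i = 2}).symm
  have e₃ := (Fintype.equivFin {i // lab i = 3}).symm
  have hsplit := fun c (hc : Admissible (Fin.last m) lab c) => orbitComb_eq_sum_add_sum_add_sum
    (A := swapLast _ hm) (fun i => H.base_span (hs.mem_span i)) hs.label_le e₁ e₂ e₃ hc
  have hlin : ∀ i, ∃ cf : Fin r → ZMod 2, ∀ x, (g i).1 x = ∑ j, cf j * γ j x := fun i => by
    obtain ⟨cf, hcf⟩ := (Submodule.mem_span_range_iff_exists_fun _).1 (hs.mem_span i)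
    exact ⟨cf, fun x => by simp [← hcf]⟩
  refine ⟨R, hR, hRb, _, _, _, card_labels_le e₁ e₂ e₃, fun i => (g (e₁ i)).1,
    fun i => (g (e₂ i)).1, fun i => (g (e₃ i)).1, fun i => hlin _, fun i => hlin _,
    fun i => hlin _, fun i => hs.symm _ (e₁ i).2, fun i => ?_, fun lam mu nu hne => ?_,
    fun j => ?_⟩
  · convert hs.sum _ (e₂ i).2 using 2
    funext x
    simp [coe_swapLast]
  · obtain ⟨c, hc, h1, h2, h3⟩ := exists_admissible (Fin.last m) e₁ e₂ e₃ lam mu nu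
    have hex : ¬ Exceptional lab c := fun hex => hne ⟨?_, ?_, ?_⟩
    · convert hreg c hc hex using 3
      rw [hsplit c hc]
      funext x
      simp [h1, h2, h3, coe_swapLast]
    · funext i
      rw [← h1, (hex _).1 (by rw [(e₁ i).2]; decide)]
      rfl
    · funext i
      rw [← h3, (hex _).1 (by rw [(e₃ i).2]; decide)]
      rfl
    · intro i ℓ ℓ'
      rw [← h2]
      exact (hex _).2 ℓ ℓ'
  · obtain ⟨c, τ, hc, hτ, hj⟩ := hs.spans j
    refine ⟨fun i => c (e₁ i) (Fin.last m), fun i => c (e₂ i), fun i => c (e₃ i), τ.1, τ.2, hτ,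
      fun x => ?_⟩
    have := congrFun (congrArg Subtype.val hj) x
    rw [hsplit c hc] at this
    refine this.trans ?_
    simp [coe_swapLast]
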